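/- The three-term recurrence of Legendre polynomials: with P_n defined by the Rodrigues formula P_n(x) = (1 / (2^n · n!)) · (d^n/dx^n)[(x² - 1)^n], for every natural number n ≥ 1 and every x ∈ ℝ, (n + 1) · P_{n+1}(x) = (2n + 1) · x · P_n(x) - n · P_{n-1}(x). -/

import Mathlib

/-- The `n`-th Legendre polynomial via the Rodrigues formula. -/
noncomputable def legendreP (n : ℕ) (x : ℝ) : ℝ :=
  (1 / (2 ^ n * (n.factorial : ℝ))) * iteratedDeriv n (fun y : ℝ => (y ^ 2 - 1) ^ n) x

open Polynomial in
theorem Polynomial.iteratedDeriv_eval (p : ℝ[X]) (k : ℕ) :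
    iteratedDeriv k (fun y : ℝ => p.eval y) = fun y => (derivative^[k] p).eval y := by
  induction k with
  | zero => simp
  | succ k ih =>
    funext y
    rw [iteratedDeriv_succ, ih, Polynomial.deriv, Function.iterate_succ_apply']

open Polynomial in
theorem legendreP_eq_eval (n : ℕ) (x : ℝ) :
    legendreP n x =
      (1 / (2 ^ n * (n.factorial : ℝ))) * (derivative^[n] ((X ^ 2 - 1 : ℝ[X]) ^ n)).eval x := by
  have h := congrFun (Polynomial.iteratedDeriv_eval ((X ^ 2 - 1 : ℝ[X]) ^ n) n) x
  simp only [eval_pow, eval_sub, eval_X, eval_one] at h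
  rw [legendreP, h]

open Polynomial in
/-- The three-term recurrence for the unnormalized polynomials `dⁿ/dXⁿ (X² - 1)ⁿ`. -/
theorem Polynomial.iterate_derivative_X_sq_sub_one_pow_recurrence (m : ℕ) :
    derivative^[m + 2] ((X ^ 2 - 1 : ℝ[X]) ^ (m + 2)) =
      C (2 * (2 * (m + 1 : ℝ) + 1)) * (X * derivative^[m + 1] ((X ^ 2 - 1 : ℝ[X]) ^ (m + 1)))
        - C (4 * (m + 1 : ℝ) ^ 2) * derivative^[m] ((X ^ 2 - 1 : ℝ[X]) ^ m) := by
  have d1 : derivative ((X ^ 2 - 1 : ℝ[X]) ^ (m + 2)) =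
      C (2 * (m + 2 : ℝ)) * ((X ^ 2 - 1) ^ (m + 1) * X) := by
    simp [derivative_pow]
    ring
  have d2 : derivative (derivative ((X ^ 2 - 1 : ℝ[X]) ^ (m + 2))) =
      C (2 * (m + 2 : ℝ) * (2 * (m + 1) + 1)) * (X ^ 2 - 1) ^ (m + 1)
        + C (4 * (m + 2 : ℝ) * (m + 1)) * (X ^ 2 - 1) ^ m := by
    rw [d1]
    simp only [derivative_mul, derivative_pow_succ, derivative_sub, derivative_X,
      derivative_one, derivative_ofNat, derivative_natCast, map_mul, map_add, map_natCast,
      map_one, map_ofNat]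
    push_cast
    ring
  have e1 : derivative^[m + 2] ((X ^ 2 - 1 : ℝ[X]) ^ (m + 2)) =
      C (2 * (m + 2 : ℝ)) * (derivative^[m + 1] ((X ^ 2 - 1 : ℝ[X]) ^ (m + 1)) * X
        + (m + 1 : ℝ[X]) * derivative^[m] ((X ^ 2 - 1 : ℝ[X]) ^ (m + 1))) := by
    rw [Function.iterate_succ_apply, d1, iterate_derivative_C_mul, iterate_derivative_mul_X]
    simp
  have e2 : derivative^[m + 2] ((X ^ 2 - 1 : ℝ[X]) ^ (m + 2)) =
      C (2 * (m + 2 : ℝ) * (2 * (m + 1) + 1)) * derivative^[m] ((X ^ 2 - 1 : ℝ[X]) ^ (m + 1))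
        + C (4 * (m + 2 : ℝ) * (m + 1)) * derivative^[m] ((X ^ 2 - 1 : ℝ[X]) ^ m) := by
    rw [Function.iterate_succ_apply, Function.iterate_succ_apply, d2, iterate_map_add,
      iterate_derivative_C_mul, iterate_derivative_C_mul]
  have hm : (m + 2 : ℝ[X]) ≠ 0 := by exact_mod_cast (Nat.succ_ne_zero (m + 1))
  refine mul_left_cancel₀ hm ?_
  simp only [map_mul, map_add, map_pow, map_natCast, map_one, map_ofNat] at e1 e2 ⊢
  linear_combination (2 * (m + 1 : ℝ[X]) + 1) * e1 - (m + 1 : ℝ[X]) * e2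

/-- The three-term recurrence of Legendre polynomials:
`(n+1) P_{n+1}(x) = (2n+1) x Pₙ(x) - n P_{n-1}(x)` for `n ≥ 1`. -/
theorem legendre_recurrence (n : ℕ) (hn : 1 ≤ n) (x : ℝ) :
    ((n : ℝ) + 1) * legendreP (n + 1) x
      = (2 * (n : ℝ) + 1) * x * legendreP n x - (n : ℝ) * legendreP (n - 1) x := by
  obtain ⟨m, rfl⟩ := Nat.exists_eq_add_of_le' hn
  have h := congrArg (Polynomial.eval x)
    (Polynomial.iterate_derivative_X_sq_sub_one_pow_recurrence m)
  simp only [Polynomial.eval_sub, Polynomial.eval_mul, Polynomial.eval_C,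
    Polynomial.eval_X] at h
  rw [Nat.add_sub_cancel, legendreP_eq_eval, legendreP_eq_eval, legendreP_eq_eval, h]
  simp only [Nat.factorial_succ]
  push_cast
  field_simp
  ring
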